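/- arXiv:1909.10905 — 2 statements merged into one kernel-verified Lean document; each statement's English description precedes it below -/
import Mathlib

section
/- For every integer n ≥ 2, the set X = {t_i : i ∈ ℤ} ∪ {s_j : 3 ≤ j ≤ n} generates the group G(∞,∞,n): every element of G(∞,∞,n) can be written as a finite product of elements of X. -/
/-- The indeterminate `x` in the field `K = ℚ(x)` of rational functions over `ℚ`. -/
noncomputable def xx : RatFunc ℚ := RatFunc.X

/-- Membership in `G(∞,∞,n)`: a monomial matrix whose nonzero entries are integer powers
of `x` and such that the product of the nonzero entries is `1`. -/
def IsGinf (n : ℕ) (w : Matrix (Fin n) (Fin n) (RatFunc ℚ)) : Prop :=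
  (∀ i : Fin n, ∃! c : Fin n, w i c ≠ 0) ∧
  (∀ c : Fin n, ∃! i : Fin n, w i c ≠ 0) ∧
  (∀ i c : Fin n, w i c ≠ 0 → ∃ k : ℤ, w i c = xx ^ k) ∧
  (∏ i : Fin n, ∑ c : Fin n, w i c) = 1

/-- The generator `t_i` (1-indexed rows/columns 1,2 are `Fin` indices 0,1). -/
noncomputable def tMat (n : ℕ) (i : ℤ) : Matrix (Fin n) (Fin n) (RatFunc ℚ) :=
  fun r c =>
    if r.val = 0 ∧ c.val = 1 then xx ^ (-i)
    else if r.val = 1 ∧ c.val = 0 then xx ^ i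
    else if r = c ∧ 2 ≤ r.val then 1 else 0

/-- The generator `s_j` (`3 ≤ j ≤ n`): permutation matrix of the transposition exchanging
coordinates `j-1` and `j` (1-indexed), i.e. `Fin` indices `j-2` and `j-1`. -/
noncomputable def sMat (n : ℕ) (j : ℕ) : Matrix (Fin n) (Fin n) (RatFunc ℚ) :=
  fun r c =>
    if (r.val + 2 = j ∧ c.val + 1 = j) ∨ (r.val + 1 = j ∧ c.val + 2 = j) ∨
       (r = c ∧ r.val + 2 ≠ j ∧ r.val + 1 ≠ j) then 1 else 0

/-- The generating set `X = {t_i : i ∈ ℤ} ∪ {s_j : 3 ≤ j ≤ n}`. -/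
def Xset (n : ℕ) : Set (Matrix (Fin n) (Fin n) (RatFunc ℚ)) :=
  {w | (∃ i : ℤ, w = tMat n i) ∨ (∃ j : ℕ, 3 ≤ j ∧ j ≤ n ∧ w = sMat n j)}

/-- `len n w` is the minimal `m` such that `w` is a product of `m` elements of `X`. -/
noncomputable def len (n : ℕ) (w : Matrix (Fin n) (Fin n) (RatFunc ℚ)) : ℕ :=
  sInf {m | ∃ L : List (Matrix (Fin n) (Fin n) (RatFunc ℚ)),
    L.length = m ∧ (∀ a ∈ L, a ∈ Xset n) ∧ L.prod = w}

/-- Left divisibility: `v ⪯ w` iff `ℓ(v) + ℓ(v⁻¹ w) = ℓ(w)`. -/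
def preL (n : ℕ) (v w : Matrix (Fin n) (Fin n) (RatFunc ℚ)) : Prop :=
  len n v + len n (v⁻¹ * w) = len n w

/-- Right divisibility: `v ⪯_r w` iff `ℓ(w v⁻¹) + ℓ(v) = ℓ(w)`. -/
def preR (n : ℕ) (v w : Matrix (Fin n) (Fin n) (RatFunc ℚ)) : Prop :=
  len n (w * v⁻¹) + len n v = len n w

/-- The element `λ = diag(x^{-(n-1)}, x, …, x)`. -/
noncomputable def lam (n : ℕ) : Matrix (Fin n) (Fin n) (RatFunc ℚ) :=
  Matrix.diagonal (fun i => if i.val = 0 then xx ^ (-((n : ℤ) - 1)) else xx)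

lemma xx_ne_zero : xx ≠ 0 := RatFunc.X_ne_zero

lemma xx_pow_eq_one {k : ℕ} (h : xx ^ k = 1) : k = 0 := by
  have h1 : algebraMap (Polynomial ℚ) (RatFunc ℚ) (Polynomial.X ^ k) =
      algebraMap (Polynomial ℚ) (RatFunc ℚ) 1 := by
    rw [map_pow, RatFunc.algebraMap_X, map_one]
    exact h
  have h2 := RatFunc.algebraMap_injective ℚ h1
  simpa using congrArg Polynomial.natDegree h2

lemma xx_zpow_eq_one {k : ℤ} (h : xx ^ k = 1) : k = 0 := by
  obtain ⟨m, rfl | rfl⟩ := k.eq_nat_or_neg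
  · rw [zpow_natCast] at h
    simpa using xx_pow_eq_one h
  · rw [zpow_neg, inv_eq_one, zpow_natCast] at h
    simpa using xx_pow_eq_one h

lemma xx_zpow_sum {ι : Type*} (s : Finset ι) (k : ι → ℤ) :
    xx ^ (∑ r ∈ s, k r) = ∏ r ∈ s, xx ^ k r := by
  classical
  induction s using Finset.induction_on with
  | empty => simp
  | insert a s ha ih => rw [Finset.sum_insert ha, Finset.prod_insert ha, zpow_add₀ xx_ne_zero, ih]

/-- The monomial matrix whose row `r` has the entry `x ^ k r` in column `σ r`. -/
noncomputable def monomialMat {n : ℕ} (σ : Equiv.Perm (Fin n)) (k : Fin n → ℤ) :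
    Matrix (Fin n) (Fin n) (RatFunc ℚ) :=
  fun r c => if σ r = c then xx ^ k r else 0

lemma monomialMat_mul {n : ℕ} (σ τ : Equiv.Perm (Fin n)) (k l : Fin n → ℤ) :
    monomialMat σ k * monomialMat τ l = monomialMat (τ * σ) (k + l ∘ σ) := by
  ext r c
  rw [Matrix.mul_apply, Finset.sum_eq_single (σ r)]
  · simp [monomialMat, zpow_add₀ xx_ne_zero]
  · intro j _ hj
    simp [monomialMat, hj.symm]
  · simp

lemma monomialMat_one_zero {n : ℕ} :
    monomialMat (1 : Equiv.Perm (Fin n)) 0 = 1 := by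
  ext r c
  simp [monomialMat, Matrix.one_apply]

lemma tMat_eq_monomialMat (m : ℕ) (i : ℤ) :
    tMat (m + 2) i = monomialMat (Equiv.swap 0 1) (Pi.single 1 i - Pi.single 0 i) := by
  ext r c
  rcases eq_or_ne r 0 with rfl | h0
  · simp [tMat, monomialMat, Fin.ext_iff, @eq_comm _ c.val]
  rcases eq_or_ne r 1 with rfl | h1
  · simp [tMat, monomialMat, Fin.ext_iff, @eq_comm _ c.val]
  · have h0' : r.val ≠ 0 := fun h => h0 (Fin.ext h)
    have h1' : r.val ≠ 1 := fun h => h1 (Fin.ext h)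
    have h2 : 2 ≤ r.val := by omega
    simp [tMat, monomialMat, Equiv.swap_apply_of_ne_of_ne h0 h1, h0, h1, h0', h1', h2]

lemma sMat_eq_monomialMat {m : ℕ} (i : Fin m) :
    sMat (m + 1) (i.val + 2) = monomialMat (Equiv.swap i.castSucc i.succ) 0 := by
  ext r c
  simp only [sMat, monomialMat, Equiv.swap_apply_def, Pi.zero_apply, zpow_zero]
  congr 1
  simp only [Fin.ext_iff, eq_iff_iff]
  split_ifs <;> simp_all <;> omega

lemma monomialMat_swap_mem (m : ℕ) (i : ℤ) :
    monomialMat (Equiv.swap 0 1) (Pi.single 1 i - Pi.single 0 i) ∈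
      Submonoid.closure (Xset (m + 2)) :=
  Submonoid.subset_closure (Or.inl ⟨i, (tMat_eq_monomialMat m i).symm⟩)

lemma monomialMat_perm_mem (m : ℕ) (σ : Equiv.Perm (Fin (m + 2))) :
    monomialMat σ 0 ∈ Submonoid.closure (Xset (m + 2)) := by
  have hσ : σ ∈ Submonoid.closure
      (Set.range fun i : Fin (m + 1) => Equiv.swap i.castSucc i.succ) := by
    rw [Equiv.Perm.mclosure_swap_castSucc_succ]
    trivial
  induction hσ using Submonoid.closure_induction with
  | mem τ hτ =>
    obtain ⟨i, rfl⟩ := hτ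
    rcases Fin.eq_zero_or_eq_succ i with rfl | ⟨j, rfl⟩
    · simpa using monomialMat_swap_mem m 0
    · refine Submonoid.subset_closure (Or.inr ⟨j.val + 3, by omega, by omega, ?_⟩)
      exact (sMat_eq_monomialMat j.succ).symm
  | one => rw [monomialMat_one_zero]; exact one_mem _
  | mul σ τ _ _ hσ hτ =>
    have h := mul_mem hτ hσ
    rw [monomialMat_mul] at h
    exact h

lemma monomialMat_diagonal_single_mem (m : ℕ) (r : Fin (m + 2)) (i : ℤ) :
    monomialMat 1 (Pi.single r i - Pi.single 0 i) ∈ Submonoid.closure (Xset (m + 2)) := by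
  rcases eq_or_ne r 0 with rfl | hr
  · rw [sub_self, monomialMat_one_zero]
    exact one_mem _
  have h := mul_mem (mul_mem (monomialMat_perm_mem m (Equiv.swap 1 r))
    (monomialMat_swap_mem m i))
    (monomialMat_perm_mem m (Equiv.swap 1 r * Equiv.swap 0 1))
  rw [monomialMat_mul, monomialMat_mul] at h
  convert h using 2
  · simp [mul_assoc]
  · ext c
    have h01 : (0 : Fin (m + 2)) ≠ 1 := by simp
    simp only [Pi.single_apply, Pi.sub_apply, Pi.add_apply, Function.comp, Pi.zero_apply,
      Equiv.swap_apply_def]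
    grind

lemma monomialMat_diagonal_mem (m : ℕ) (k : Fin (m + 2) → ℤ) (hk : ∑ r, k r = 0) :
    monomialMat 1 k ∈ Submonoid.closure (Xset (m + 2)) := by
  have hsum : k = ∑ r, (Pi.single r (k r) - Pi.single 0 (k r)) := by
    ext c
    rw [Finset.sum_sub_distrib, Finset.univ_sum_single]
    rcases eq_or_ne c 0 with rfl | hc
    · simp [Finset.sum_apply, hk]
    · simp [Finset.sum_apply, hc]
  rw [hsum]
  refine Finset.sum_induction _
    (fun l => monomialMat 1 l ∈ Submonoid.closure (Xset (m + 2))) (fun a b ha hb => ?_)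
    ?_ (fun r _ => monomialMat_diagonal_single_mem m r (k r))
  · have h := mul_mem ha hb
    rw [monomialMat_mul] at h
    exact h
  · rw [monomialMat_one_zero]
    exact one_mem _

lemma IsGinf.exists_eq_monomialMat {n : ℕ} {w : Matrix (Fin n) (Fin n) (RatFunc ℚ)}
    (hw : IsGinf n w) :
    ∃ (σ : Equiv.Perm (Fin n)) (k : Fin n → ℤ), ∑ r, k r = 0 ∧ w = monomialMat σ k := by
  obtain ⟨hrow, hcol, hpow, hprod⟩ := hw
  choose f hf hf' using hrow
  choose k hk using fun r => hpow r (f r) (hf r)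
  have hinj : Function.Injective f := fun a b hab =>
    (hcol (f a)).unique (hf a) (hab ▸ hf b)
  have hw : w = monomialMat (Equiv.ofBijective f (Finite.injective_iff_bijective.mp hinj)) k := by
    ext r c
    by_cases h : f r = c
    · subst h
      simp [monomialMat, hk]
    · have h0 : w r c = 0 := by
        by_contra hne
        exact h (hf' r c hne).symm
      simp [monomialMat, h, h0]
  refine ⟨_, k, xx_zpow_eq_one ?_, hw⟩
  have hrowsum (r : Fin n) : ∑ c, w r c = xx ^ k r := by
    rw [hw]
    simp [monomialMat]
  simp only [hrowsum] at hprod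
  rw [← hprod, xx_zpow_sum]

/-- `X` generates `G(∞,∞,n)`: every element of `G(∞,∞,n)` is a finite product
of elements of `X`. -/
theorem stmt_0 (n : ℕ) (hn : 2 ≤ n) (w : Matrix (Fin n) (Fin n) (RatFunc ℚ))
    (hw : IsGinf n w) :
    ∃ L : List (Matrix (Fin n) (Fin n) (RatFunc ℚ)),
      (∀ a ∈ L, a ∈ Xset n) ∧ L.prod = w := by
  obtain ⟨m, rfl⟩ := Nat.exists_eq_add_of_le' hn
  obtain ⟨σ, k, hk, rfl⟩ := hw.exists_eq_monomialMat
  refine Submonoid.exists_list_of_mem_closure ?_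
  have h := mul_mem (monomialMat_diagonal_mem m k hk) (monomialMat_perm_mem m σ)
  rw [monomialMat_mul] at h
  simpa using h
end

section
/- Let n ≥ 3 and w ∈ G(∞,∞,n); for each row index i let c_i be the unique column with w[i,c_i] ≠ 0 and set a_i = w[i,c_i]. Then for every i with 3 ≤ i ≤ n: (a) if c_{i−1} < c_i then ℓ(s_i w) = ℓ(w) − 1 if and only if a_i ≠ 1; (b) if c_{i−1} > c_i then ℓ(s_i w) = ℓ(w) − 1 if and only if a_{i−1} = 1. -/
lemma xx_zpow_eq_one_iff (k : ℤ) : xx ^ k = 1 ↔ k = 0 := by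
  have key : ∀ m : ℕ, xx ^ m = 1 → m = 0 := by
    intro m hm
    have h1 : algebraMap (Polynomial ℚ) (RatFunc ℚ) (Polynomial.X ^ m) =
        algebraMap (Polynomial ℚ) (RatFunc ℚ) 1 := by
      rw [map_pow, RatFunc.algebraMap_X, map_one]
      exact hm
    have h2 := congrArg Polynomial.natDegree (RatFunc.algebraMap_injective ℚ h1)
    simpa using h2
  constructor
  · intro h
    rcases Int.eq_nat_or_neg k with ⟨m, rfl | rfl⟩
    · rw [zpow_natCast] at h
      simp [key m h]
    · rw [zpow_neg, zpow_natCast, inv_eq_one] at h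
      simp [key m h]
  · rintro rfl
    simp

/-- The monomial matrix whose row `r` has its nonzero entry `x ^ a r` in column `σ r`. -/
noncomputable def monoMat {n : ℕ} (σ : Equiv.Perm (Fin n)) (a : Fin n → ℤ) :
    Matrix (Fin n) (Fin n) (RatFunc ℚ) :=
  fun r c => if c = σ r then xx ^ a r else 0

/-- The monomial matrix exchanging the coordinates `p` and `q` with weights `x ^ (-k)`, `x ^ k`. -/
noncomputable def genMat {n : ℕ} (p q : Fin n) (k : ℤ) : Matrix (Fin n) (Fin n) (RatFunc ℚ) :=
  monoMat (Equiv.swap p q) (fun r => if r = p then -k else if r = q then k else 0)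

/-- The exponents of `genMat p q k * monoMat σ a`. -/
def moveExp {n : ℕ} (p q : Fin n) (k : ℤ) (a : Fin n → ℤ) : Fin n → ℤ :=
  fun r => if r = p then a q - k else if r = q then a p + k else a r

/-- The parameters `(p, q, k)` for which `genMat p q k` is one of the generators. -/
def IsGenIndex {n : ℕ} (p q : Fin n) (k : ℤ) : Prop :=
  q.val = p.val + 1 ∧ (k = 0 ∨ p.val = 0)

/-- The contribution of the pair of rows `j < i` to the length of `monoMat σ a`. -/
def pairWeight {n : ℕ} (σ : Equiv.Perm (Fin n)) (a : Fin n → ℤ) (j i : Fin n) : ℕ :=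
  if σ i < σ j then 1 else if a i = 0 then 0 else 2

/-- The combinatorial formula for the length of `monoMat σ a`. -/
def weight {n : ℕ} (σ : Equiv.Perm (Fin n)) (a : Fin n → ℤ) : ℕ :=
  ∑ z : Fin n × Fin n with z.1 < z.2, pairWeight σ a z.1 z.2

lemma monoMat_apply_ne_zero {n : ℕ} (σ : Equiv.Perm (Fin n)) (a : Fin n → ℤ) (r c : Fin n) :
    monoMat σ a r c ≠ 0 ↔ c = σ r := by
  unfold monoMat
  split_ifs with h <;> simp [h, zpow_ne_zero, xx_ne_zero]

lemma monoMat_apply_self {n : ℕ} (σ : Equiv.Perm (Fin n)) (a : Fin n → ℤ) (r : Fin n) :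
    monoMat σ a r (σ r) = xx ^ a r := by
  simp [monoMat]

lemma monoMat_injective {n : ℕ} {σ τ : Equiv.Perm (Fin n)} {a b : Fin n → ℤ}
    (h : monoMat σ a = monoMat τ b) : σ = τ ∧ a = b := by
  have hστ : σ = τ := by
    ext1 r
    rw [← monoMat_apply_ne_zero τ b, ← h, monoMat_apply_ne_zero]
  subst hστ
  refine ⟨rfl, funext fun r => ?_⟩
  have hr := congrFun (congrFun h r) (σ r)
  rw [monoMat_apply_self, monoMat_apply_self] at hr
  have : xx ^ (a r - b r) = 1 := by
    rw [zpow_sub₀ xx_ne_zero, hr, div_self (zpow_ne_zero _ xx_ne_zero)]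
  have := (xx_zpow_eq_one_iff _).1 this
  omega

lemma monoMat_one_zero {n : ℕ} : monoMat (1 : Equiv.Perm (Fin n)) 0 = 1 := by
  ext r c
  simp [monoMat, Matrix.one_apply, eq_comm]

lemma monoMat_mul {n : ℕ} (σ τ : Equiv.Perm (Fin n)) (a b : Fin n → ℤ) :
    monoMat τ b * monoMat σ a = monoMat (σ * τ) (fun r => b r + a (τ r)) := by
  ext r c
  rw [Matrix.mul_apply, Finset.sum_eq_single (τ r)]
  · simp [monoMat, zpow_add₀ xx_ne_zero]
  · intro s _ hs
    simp [monoMat, hs]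
  · simp

lemma genMat_mul_monoMat {n : ℕ} {p q : Fin n} (k : ℤ) (hpq : p ≠ q)
    (σ : Equiv.Perm (Fin n)) (a : Fin n → ℤ) :
    genMat p q k * monoMat σ a = monoMat (σ * Equiv.swap p q) (moveExp p q k a) := by
  rw [genMat, monoMat_mul]
  congr 1
  funext r
  unfold moveExp
  by_cases h1 : r = p
  · subst h1; simp; ring
  · by_cases h2 : r = q
    · subst h2; simp [h1]; ring
    · simp [h1, h2, Equiv.swap_apply_of_ne_of_ne h1 h2]

lemma genMat_mul_self {n : ℕ} {p q : Fin n} (k : ℤ) (hpq : p ≠ q) :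
    genMat p q k * genMat p q k = 1 := by
  conv_lhs => rw [genMat, monoMat_mul]
  rw [← monoMat_one_zero]
  congr 1
  · simp
  · funext r
    by_cases h1 : r = p
    · subst h1; simp [hpq.symm]
    · by_cases h2 : r = q
      · subst h2; simp [h1]
      · simp [h1, h2, Equiv.swap_apply_of_ne_of_ne h1 h2]

lemma sum_moveExp {n : ℕ} {p q : Fin n} (k : ℤ) (hpq : p ≠ q) (a : Fin n → ℤ) :
    ∑ r, moveExp p q k a r = ∑ r, a r := by
  have h : ∀ r, moveExp p q k a r =
      a (Equiv.swap p q r) + ((if r = q then k else 0) - (if r = p then k else 0)) := by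
    intro r
    unfold moveExp
    by_cases h1 : r = p
    · subst h1; simp [hpq]; ring
    · by_cases h2 : r = q
      · subst h2; simp [h1]
      · simp [h1, h2, Equiv.swap_apply_of_ne_of_ne h1 h2]
  simp only [h, Finset.sum_add_distrib, Finset.sum_sub_distrib, Equiv.sum_comp]
  simp

lemma IsGenIndex.ne {n : ℕ} {p q : Fin n} {k : ℤ} (h : IsGenIndex p q k) : p ≠ q := by
  intro e
  have := h.1
  rw [e] at this
  omega

lemma tMat_eq_genMat {n : ℕ} {p q : Fin n} (hp : p.val = 0) (hq : q.val = 1) (k : ℤ) :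
    tMat n k = genMat p q k := by
  ext r c
  unfold tMat genMat monoMat
  simp only [Equiv.swap_apply_def, Fin.ext_iff]
  grind [zpow_zero]

lemma sMat_eq_genMat {n j : ℕ} {p q : Fin n} (hp : p.val + 2 = j) (hq : q.val + 1 = j) :
    sMat n j = genMat p q 0 := by
  ext r c
  unfold sMat genMat monoMat
  simp only [Equiv.swap_apply_def, Fin.ext_iff, neg_zero, ite_self, zpow_zero]
  grind

lemma mem_Xset_iff {n : ℕ} (hn : 2 ≤ n) (A : Matrix (Fin n) (Fin n) (RatFunc ℚ)) :
    A ∈ Xset n ↔ ∃ p q k, IsGenIndex p q k ∧ A = genMat p q k := by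
  constructor
  · rintro (⟨k, rfl⟩ | ⟨j, h3, hj, rfl⟩)
    · exact ⟨⟨0, by omega⟩, ⟨1, by omega⟩, k, ⟨rfl, Or.inr rfl⟩, tMat_eq_genMat rfl rfl k⟩
    · obtain ⟨m, rfl⟩ : ∃ m, j = m + 2 := ⟨j - 2, by omega⟩
      exact ⟨⟨m, by omega⟩, ⟨m + 1, by omega⟩, 0, ⟨rfl, Or.inl rfl⟩, sMat_eq_genMat rfl rfl⟩
  · rintro ⟨p, q, k, ⟨hq, hk⟩, rfl⟩
    by_cases hp : p.val = 0
    · exact Or.inl ⟨k, (tMat_eq_genMat hp (by omega) k).symm⟩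
    · obtain rfl := hk.resolve_right hp
      exact Or.inr ⟨p.val + 2, by omega, by omega, (sMat_eq_genMat rfl (by omega)).symm⟩

/-- A generator changes the weight only through the pair of rows it exchanges. -/
lemma weight_move {n : ℕ} {p q : Fin n} {k : ℤ} (h : IsGenIndex p q k)
    (σ : Equiv.Perm (Fin n)) (a : Fin n → ℤ) :
    weight (σ * Equiv.swap p q) (moveExp p q k a) + pairWeight σ a p q =
      weight σ a + (if σ p < σ q then 1 else if a p + k = 0 then 0 else 2) := by
  have hne := h.ne
  obtain ⟨hq, hk⟩ := h
  have hmem : (p, q) ∈ ({z : Fin n × Fin n | z.1 < z.2} : Finset _) := by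
    rw [Finset.mem_filter]
    exact ⟨Finset.mem_univ _, by rw [Fin.lt_def]; dsimp only; omega⟩
  have hpair : pairWeight (σ * Equiv.swap p q) (moveExp p q k a) p q =
      (if σ p < σ q then 1 else if a p + k = 0 then 0 else 2) := by
    simp [pairWeight, moveExp, hne.symm]
  have hlt : ∀ j i : Fin n, j < i → (j, i) ≠ (p, q) →
      Equiv.swap p q j < Equiv.swap p q i ∧
        (Equiv.swap p q j, Equiv.swap p q i) ≠ (p, q) := by
    intro j i hji hz
    rw [Fin.lt_def] at hji ⊢
    simp only [ne_eq, Prod.mk.injEq, Equiv.swap_apply_def, Fin.ext_iff] at hz ⊢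
    grind
  unfold weight
  rw [← Finset.add_sum_erase _ _ hmem, ← Finset.add_sum_erase _ _ hmem, hpair]
  have : ∑ z ∈ ({z : Fin n × Fin n | z.1 < z.2} : Finset _).erase (p, q),
        pairWeight (σ * Equiv.swap p q) (moveExp p q k a) z.1 z.2 =
      ∑ z ∈ ({z : Fin n × Fin n | z.1 < z.2} : Finset _).erase (p, q),
        pairWeight σ a z.1 z.2 := by
    refine Finset.sum_nbij' (Prod.map (Equiv.swap p q) (Equiv.swap p q))
      (Prod.map (Equiv.swap p q) (Equiv.swap p q)) ?_ ?_ ?_ ?_ ?_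
    · rintro ⟨j, i⟩ hz
      simp only [Finset.mem_erase, Finset.mem_filter, Finset.mem_univ, true_and] at hz
      have := hlt j i hz.2 hz.1
      simpa [and_comm] using this
    · rintro ⟨j, i⟩ hz
      simp only [Finset.mem_erase, Finset.mem_filter, Finset.mem_univ, true_and] at hz
      have := hlt j i hz.2 hz.1
      simpa [and_comm] using this
    · rintro ⟨j, i⟩ _
      simp
    · rintro ⟨j, i⟩ _
      simp
    · rintro ⟨j, i⟩ hz
      simp only [Finset.mem_erase, Finset.mem_filter, Finset.mem_univ, true_and] at hz
      have hexp : moveExp p q k a i = a (Equiv.swap p q i) := by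
        simp only [ne_eq, Prod.mk.injEq, Fin.ext_iff, ← Fin.val_fin_lt] at hz
        simp only [moveExp, Equiv.swap_apply_def, Fin.ext_iff]
        grind
      simp [pairWeight, hexp]
  rw [this]
  ring

lemma weight_move_le {n : ℕ} {p q : Fin n} {k : ℤ} (h : IsGenIndex p q k)
    (σ : Equiv.Perm (Fin n)) (a : Fin n → ℤ) :
    weight (σ * Equiv.swap p q) (moveExp p q k a) ≤ weight σ a + 1 := by
  have h1 := weight_move h σ a
  have h2 : σ p ≠ σ q := fun e => h.ne (σ.injective e)
  unfold pairWeight at h1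
  simp only [ne_eq, Fin.ext_iff, ← Fin.val_fin_lt] at h1 h2
  grind

lemma weight_one_zero {n : ℕ} : weight (1 : Equiv.Perm (Fin n)) 0 = 0 := by
  unfold weight
  refine Finset.sum_eq_zero ?_
  rintro ⟨j, i⟩ hz
  simp only [Finset.mem_filter, Finset.mem_univ, true_and] at hz
  simp [pairWeight, hz.le]

/-- Every element other than the identity has its weight lowered by some generator. -/
lemma exists_weight_move_lt {n : ℕ} (hn : 2 ≤ n) (σ : Equiv.Perm (Fin n)) (a : Fin n → ℤ)
    (ha : ∑ r, a r = 0) (hne : ¬ (σ = 1 ∧ a = 0)) :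
    ∃ p q k, IsGenIndex p q k ∧
      weight (σ * Equiv.swap p q) (moveExp p q k a) + 1 = weight σ a := by
  by_contra! hcon
  have step : ∀ p q : Fin n, q.val = p.val + 1 → (p.val = 0 ∨ a p = 0) →
      σ p < σ q ∧ a q = 0 := by
    intro p q hq hp
    have hgen : IsGenIndex p q (- a p) := ⟨hq, by omega⟩
    have h1 := weight_move hgen σ a
    have h2 := hcon p q _ hgen
    have h3 : σ p ≠ σ q := fun e => hgen.ne (σ.injective e)
    unfold pairWeight at h1
    simp only [ne_eq, Fin.ext_iff, ← Fin.val_fin_lt] at h1 h3 ⊢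
    grind
  have hzero : ∀ m (hm : m + 1 < n), a ⟨m + 1, hm⟩ = 0 := by
    intro m
    induction m with
    | zero => exact fun hm => (step ⟨0, by omega⟩ _ rfl (Or.inl rfl)).2
    | succ m ih => exact fun hm => (step ⟨m + 1, by omega⟩ _ rfl (Or.inr (ih _))).2
  have hz : ∀ p : Fin n, p.val = 0 ∨ a p = 0 := by
    rintro ⟨_ | m, hm⟩
    · exact Or.inl rfl
    · exact Or.inr (hzero m hm)
  obtain ⟨m, rfl⟩ : ∃ m, n = m + 1 := ⟨n - 1, by omega⟩
  have hmono : StrictMono σ :=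
    Fin.strictMono_iff_lt_succ.2 fun i => (step i.castSucc i.succ (by simp) (hz _)).1
  refine hne ⟨?_, ?_⟩
  · have : (hmono.orderIsoOfSurjective σ σ.surjective) = OrderIso.refl _ :=
      Subsingleton.elim _ _
    ext1 r
    exact congrFun (congrArg DFunLike.coe this) r
  · funext r
    rw [Fin.sum_univ_succ] at ha
    have hs : ∀ i : Fin m, a i.succ = 0 := fun i => (hz i.succ).resolve_left (by simp)
    simp only [hs, Finset.sum_const_zero, add_zero] at ha
    rcases Fin.eq_zero_or_eq_succ r with rfl | ⟨i, rfl⟩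
    · exact ha
    · exact hs i

lemma exists_list_prod_eq_monoMat {n : ℕ} (hn : 2 ≤ n) (m : ℕ) :
    ∀ (σ : Equiv.Perm (Fin n)) (a : Fin n → ℤ), ∑ r, a r = 0 → weight σ a = m →
      ∃ L : List (Matrix (Fin n) (Fin n) (RatFunc ℚ)),
        L.length = m ∧ (∀ A ∈ L, A ∈ Xset n) ∧ L.prod = monoMat σ a := by
  induction m with
  | zero =>
    intro σ a ha hw
    by_cases h : σ = 1 ∧ a = 0
    · obtain ⟨rfl, rfl⟩ := h
      exact ⟨[], rfl, by simp, by simp [monoMat_one_zero]⟩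
    · obtain ⟨p, q, k, -, h'⟩ := exists_weight_move_lt hn σ a ha h
      omega
  | succ m ih =>
    intro σ a ha hw
    have h : ¬ (σ = 1 ∧ a = 0) := by
      rintro ⟨rfl, rfl⟩
      rw [weight_one_zero] at hw
      omega
    obtain ⟨p, q, k, hg, h'⟩ := exists_weight_move_lt hn σ a ha h
    obtain ⟨L, hL, hX, hprod⟩ := ih (σ * Equiv.swap p q) (moveExp p q k a)
      (by rw [sum_moveExp k hg.ne, ha]) (by omega)
    refine ⟨genMat p q k :: L, by simp [hL], ?_, ?_⟩
    · simp only [List.mem_cons, forall_eq_or_imp]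
      exact ⟨(mem_Xset_iff hn _).2 ⟨p, q, k, hg, rfl⟩, hX⟩
    · rw [List.prod_cons, hprod, ← genMat_mul_monoMat k hg.ne, ← mul_assoc,
        genMat_mul_self k hg.ne, one_mul]

lemma exists_monoMat_eq_list_prod {n : ℕ} (hn : 2 ≤ n)
    (L : List (Matrix (Fin n) (Fin n) (RatFunc ℚ))) (hL : ∀ A ∈ L, A ∈ Xset n) :
    ∃ (σ : Equiv.Perm (Fin n)) (a : Fin n → ℤ),
      L.prod = monoMat σ a ∧ weight σ a ≤ L.length := by
  induction L with
  | nil => exact ⟨1, 0, by simp [monoMat_one_zero], by simp [weight_one_zero]⟩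
  | cons A L ih =>
    simp only [List.mem_cons, forall_eq_or_imp] at hL
    obtain ⟨σ, a, hprod, hw⟩ := ih hL.2
    obtain ⟨p, q, k, hg, rfl⟩ := (mem_Xset_iff hn _).1 hL.1
    refine ⟨σ * Equiv.swap p q, moveExp p q k a, ?_, ?_⟩
    · rw [List.prod_cons, hprod, genMat_mul_monoMat k hg.ne]
    · have := weight_move_le hg σ a
      simp only [List.length_cons]
      omega

lemma len_monoMat {n : ℕ} (hn : 2 ≤ n) (σ : Equiv.Perm (Fin n)) (a : Fin n → ℤ)
    (ha : ∑ r, a r = 0) : len n (monoMat σ a) = weight σ a := by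
  refine IsLeast.csInf_eq ⟨exists_list_prod_eq_monoMat hn _ σ a ha rfl, ?_⟩
  rintro m ⟨L, rfl, hX, hprod⟩
  obtain ⟨τ, b, hprod', hw⟩ := exists_monoMat_eq_list_prod hn L hX
  obtain ⟨rfl, rfl⟩ := monoMat_injective (hprod.symm.trans hprod')
  exact hw

lemma IsGinf.exists_eq_monoMat {n : ℕ} {w : Matrix (Fin n) (Fin n) (RatFunc ℚ)}
    (hw : IsGinf n w) : ∃ (σ : Equiv.Perm (Fin n)) (a : Fin n → ℤ),
      w = monoMat σ a ∧ ∑ r, a r = 0 := by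
  obtain ⟨hrow, hcol, hpow, hprod⟩ := hw
  choose c hc hcu using hrow
  choose a ha using fun r => hpow r (c r) (hc r)
  have hinj : Function.Injective c := fun r s h =>
    (hcol (c r)).unique (hc r) (by rw [h]; exact hc s)
  let σ : Equiv.Perm (Fin n) := Equiv.ofBijective c (Finite.injective_iff_bijective.1 hinj)
  have hwσ : w = monoMat σ a := by
    ext r s
    by_cases h : s = c r
    · subst h
      exact (ha r).trans (monoMat_apply_self σ a r).symm
    · have h0 : w r s = 0 := by
        by_contra h1
        exact h (hcu r s h1)
      rw [h0, eq_comm]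
      by_contra h1
      exact h ((monoMat_apply_ne_zero σ a r s).1 h1)
  refine ⟨σ, a, hwσ, ?_⟩
  have hsum : ∀ r, ∑ s, w r s = xx ^ a r := by
    intro r
    simp [hwσ, monoMat]
  have hprod_zpow : ∀ S : Finset (Fin n), ∏ r ∈ S, xx ^ a r = xx ^ ∑ r ∈ S, a r := by
    intro S
    induction S using Finset.induction_on with
    | empty => simp
    | insert r S hr ih => rw [Finset.prod_insert hr, Finset.sum_insert hr, ih,
        zpow_add₀ xx_ne_zero]
  simp only [hsum] at hprod
  rwa [hprod_zpow, xx_zpow_eq_one_iff] at hprod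

/-- rows `i` and `i-1`, 1-indexed, are `Fin` indices `i-1` and `i-2`. -/
theorem stmt_1 (n : ℕ) (hn : 3 ≤ n) (w : Matrix (Fin n) (Fin n) (RatFunc ℚ))
    (hw : IsGinf n w) (c : Fin n → Fin n) (hc : ∀ r : Fin n, w r (c r) ≠ 0)
    (i : ℕ) (hi3 : 3 ≤ i) (hin : i ≤ n) :
    (((c ⟨i - 2, by omega⟩ : ℕ) < (c ⟨i - 1, by omega⟩ : ℕ)) →
      ((len n (sMat n i * w) : ℤ) = (len n w : ℤ) - 1 ↔
        w ⟨i - 1, by omega⟩ (c ⟨i - 1, by omega⟩) ≠ 1)) ∧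
    (((c ⟨i - 1, by omega⟩ : ℕ) < (c ⟨i - 2, by omega⟩ : ℕ)) →
      ((len n (sMat n i * w) : ℤ) = (len n w : ℤ) - 1 ↔
        w ⟨i - 2, by omega⟩ (c ⟨i - 2, by omega⟩) = 1)) := by
  obtain ⟨σ, a, rfl, ha⟩ := hw.exists_eq_monoMat
  have hcσ : ∀ r, c r = σ r := fun r => (monoMat_apply_ne_zero σ a r (c r)).1 (hc r)
  have hg : IsGenIndex (⟨i - 2, by omega⟩ : Fin n) ⟨i - 1, by omega⟩ 0 :=
    ⟨by simp only; omega, Or.inl rfl⟩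
  have hmove := weight_move hg σ a
  rw [sMat_eq_genMat (p := ⟨i - 2, by omega⟩) (q := ⟨i - 1, by omega⟩) (by simp only; omega)
    (by simp only; omega), genMat_mul_monoMat _ hg.ne, len_monoMat (by omega) _ _ ha,
    len_monoMat (by omega) _ _ (by rw [sum_moveExp _ hg.ne, ha])]
  simp only [hcσ, monoMat_apply_self, ne_eq, xx_zpow_eq_one_iff]
  unfold pairWeight at hmove
  simp only [← Fin.val_fin_lt] at hmove
  constructor <;> intro hlt <;> grind
end
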